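/- Equation (3.17) (Sylvester's identity): Let α be a repetition-free word of row indices and β a repetition-free word of column indices with |α| = |β|; let x₁,…,x_n (n ≥ 1) be distinct row indices not occurring in α and y₁,…,y_n distinct column indices not occurring in β. Then A[α,β]^{n−1}·A[αx₁⋯x_n, βy₁⋯y_n] equals the determinant of the n×n matrix C whose (i,j) entry is C_{ij} = A[αx_i, βy_j]. -/

import Mathlib

/-- `listDet A α β` is the determinant `A[α,β]` of the square matrix whose `(i,j)` entry is
`A αᵢ βⱼ`, for words `α`, `β` of equal length (and junk value `0` otherwise). -/
def listDet {I J R : Type*} [CommRing R] (A : I → J → R) (α : List I) (β : List J) : R :=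
  if h : α.length = β.length then
    Matrix.det (Matrix.of fun i j : Fin α.length => A (α.get i) (β.get (Fin.cast h j)))
  else 0


namespace Matrix

variable {m n R S : Type*} [Fintype m] [DecidableEq m] [CommRing R] [CommRing S]

/-- The matrix of the minors of `M` obtained by bordering its upper left block
by one row and one column. -/
def borderedMinors (M : Matrix (m ⊕ n) (m ⊕ n) R) : Matrix n n R :=
  of fun i j => det (M.submatrix (Sum.map id fun _ : Fin 1 => i) (Sum.map id fun _ : Fin 1 => j))

theorem borderedMinors_map (f : R →+* S) (M : Matrix (m ⊕ n) (m ⊕ n) R) :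
    borderedMinors (M.map f) = (borderedMinors M).map f := by
  ext i j
  simp only [borderedMinors, of_apply, map_apply, RingHom.map_det, RingHom.mapMatrix_apply,
    submatrix_map]

variable [DecidableEq n]

theorem det_toBlocks₁₁_mvPolynomialX_ne_zero [Nontrivial R] :
    (mvPolynomialX (m ⊕ n) (m ⊕ n) R).toBlocks₁₁.det ≠ 0 := by
  intro h
  have h1 := congrArg (MvPolynomial.eval fun p : (m ⊕ n) × (m ⊕ n) =>
    (1 : Matrix (m ⊕ n) (m ⊕ n) R) p.1 p.2) h
  rw [RingHom.map_det, map_zero] at h1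
  have h2 : (MvPolynomial.eval fun p : (m ⊕ n) × (m ⊕ n) =>
      (1 : Matrix (m ⊕ n) (m ⊕ n) R) p.1 p.2).mapMatrix
        (mvPolynomialX (m ⊕ n) (m ⊕ n) R).toBlocks₁₁ = 1 := by
    ext i j
    simp [toBlocks₁₁, one_apply]
  rw [h2, det_one] at h1
  exact one_ne_zero h1

variable [Fintype n]

theorem map_toBlocks₁₁_det_pow_mul_det (f : R →+* S) (k : ℕ) (M : Matrix (m ⊕ n) (m ⊕ n) R) :
    f (M.toBlocks₁₁.det ^ k * M.det) = (M.map f).toBlocks₁₁.det ^ k * (M.map f).det := by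
  rw [map_mul, map_pow, RingHom.map_det, RingHom.map_det]
  rfl

theorem map_det_borderedMinors (f : R →+* S) (M : Matrix (m ⊕ n) (m ⊕ n) R) :
    f (borderedMinors M).det = (borderedMinors (M.map f)).det := by
  rw [borderedMinors_map, RingHom.map_det]
  rfl

/-- Sylvester's identity when the upper left block is invertible. -/
theorem det_borderedMinors_of_isUnit [Nonempty n] (M : Matrix (m ⊕ n) (m ⊕ n) R)
    (h : IsUnit M.toBlocks₁₁.det) :
    M.toBlocks₁₁.det ^ (Fintype.card n - 1) * M.det = (borderedMinors M).det := by
  let : Invertible M.toBlocks₁₁ := invertibleOfIsUnitDet _ h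
  have key : borderedMinors M = M.toBlocks₁₁.det •
      (M.toBlocks₂₂ - M.toBlocks₂₁ * ⅟M.toBlocks₁₁ * M.toBlocks₁₂) := by
    ext i j
    have hb : M.submatrix (Sum.map id fun _ : Fin 1 => i) (Sum.map id fun _ : Fin 1 => j) =
        fromBlocks M.toBlocks₁₁ (M.toBlocks₁₂.submatrix id fun _ => j)
          (M.toBlocks₂₁.submatrix (fun _ => i) id)
          (M.toBlocks₂₂.submatrix (fun _ => i) fun _ => j) := by
      ext (_ | _) (_ | _) <;> rfl
    simp only [borderedMinors, of_apply]
    rw [hb, det_fromBlocks₁₁, det_fin_one]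
    rfl
  have hM : M.det = M.toBlocks₁₁.det *
      (M.toBlocks₂₂ - M.toBlocks₂₁ * ⅟M.toBlocks₁₁ * M.toBlocks₁₂).det := by
    rw [← det_fromBlocks₁₁, fromBlocks_toBlocks]
  rw [key, det_smul, hM, ← mul_assoc, pow_sub_one_mul Fintype.card_ne_zero]

/-- **Sylvester's determinant identity** for block matrices. -/
theorem det_borderedMinors [Nonempty n] (M : Matrix (m ⊕ n) (m ⊕ n) R) :
    M.toBlocks₁₁.det ^ (Fintype.card n - 1) * M.det = (borderedMinors M).det := by
  let P := MvPolynomial ((m ⊕ n) × (m ⊕ n)) ℤ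
  let X : Matrix (m ⊕ n) (m ⊕ n) P := mvPolynomialX (m ⊕ n) (m ⊕ n) ℤ
  have generic : X.toBlocks₁₁.det ^ (Fintype.card n - 1) * X.det = (borderedMinors X).det := by
    apply IsFractionRing.injective P (FractionRing P)
    rw [map_toBlocks₁₁_det_pow_mul_det, map_det_borderedMinors]
    apply det_borderedMinors_of_isUnit
    have h : (X.map (algebraMap P (FractionRing P))).toBlocks₁₁.det =
        algebraMap P (FractionRing P) X.toBlocks₁₁.det := by
      rw [RingHom.map_det]; rfl
    rw [h, isUnit_iff_ne_zero]
    exact (map_ne_zero_iff _ (IsFractionRing.injective P (FractionRing P))).2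
      det_toBlocks₁₁_mvPolynomialX_ne_zero
  have hX : X.map (MvPolynomial.eval₂Hom (Int.castRingHom R) fun p => M p.1 p.2) = M :=
    mvPolynomialX_map_eval₂ _ M
  have h := congrArg (MvPolynomial.eval₂Hom (Int.castRingHom R) fun p => M p.1 p.2) generic
  rwa [map_toBlocks₁₁_det_pow_mul_det, map_det_borderedMinors, hX] at h

end Matrix

section listDet

variable {I J R : Type*} [CommRing R] (A : I → J → R)

theorem listDet_ofFn {k : ℕ} (u : Fin k → I) (v : Fin k → J) :
    listDet A (List.ofFn u) (List.ofFn v) = Matrix.det (Matrix.of fun i j => A (u i) (v j)) := by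
  rw [listDet, dif_pos (by simp),
    ← Matrix.det_submatrix_equiv_self (finCongr (List.length_ofFn (f := u)))]
  congr 1
  ext i j
  simp [Fin.cast]

theorem listDet_ofFn_append {k l : ℕ} (a : Fin k → I) (b : Fin k → J)
    (u : Fin l → I) (v : Fin l → J) :
    listDet A (List.ofFn a ++ List.ofFn u) (List.ofFn b ++ List.ofFn v) =
      Matrix.det (Matrix.of fun i j => A (Sum.elim a u i) (Sum.elim b v j)) := by
  rw [← List.ofFn_fin_append, ← List.ofFn_fin_append, listDet_ofFn,
    ← Matrix.det_submatrix_equiv_self finSumFinEquiv]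
  congr 1
  ext (i | i) (j | j) <;> simp

end listDet

/-- **Equation (3.17)** (Sylvester's identity): if `α`, `β` are repetition-free row/column
words with `|α| = |β|`, and `x₁,…,xₙ` (resp. `y₁,…,yₙ`), `n ≥ 1`, are distinct row (resp.
column) indices not occurring in `α` (resp. `β`), then
`A[α,β]^{n−1}·A[αx₁⋯xₙ, βy₁⋯yₙ] = det C` where `C i j = A[αxᵢ, βyⱼ]`. -/
theorem sylvester_identity {I J R : Type*} [CommRing R] (A : I → J → R)
    (n : ℕ) (hn : 1 ≤ n) (α : List I) (β : List J) (hlen : α.length = β.length)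
    (x : Fin n → I) (y : Fin n → J)
    (hrow : (α ++ List.ofFn x).Nodup) (hcol : (β ++ List.ofFn y).Nodup) :
    listDet A α β ^ (n - 1) * listDet A (α ++ List.ofFn x) (β ++ List.ofFn y) =
      Matrix.det (Matrix.of fun i j : Fin n =>
        listDet A (α ++ [x i]) (β ++ [y j])) := by
  obtain ⟨k, a, rfl⟩ : ∃ (k : ℕ) (a : Fin k → I), α = List.ofFn a :=
    ⟨_, α.get, (List.ofFn_get α).symm⟩
  obtain ⟨b, rfl⟩ : ∃ b : Fin k → J, β = List.ofFn b := by
    rw [List.length_ofFn] at hlen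
    subst hlen
    exact ⟨β.get, (List.ofFn_get β).symm⟩
  have : Nonempty (Fin n) := ⟨⟨0, hn⟩⟩
  have h := Matrix.det_borderedMinors
    (Matrix.of fun i j : Fin k ⊕ Fin n => A (Sum.elim a x i) (Sum.elim b y j))
  rw [Fintype.card_fin] at h
  rw [listDet_ofFn_append, listDet_ofFn]
  refine h.trans (congrArg Matrix.det ?_)
  ext i j
  have hx : [x i] = List.ofFn fun _ : Fin 1 => x i := by simp
  have hy : [y j] = List.ofFn fun _ : Fin 1 => y j := by simp
  rw [Matrix.of_apply, hx, hy, listDet_ofFn_append, Matrix.borderedMinors, Matrix.of_apply]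
  congr 1
  ext (_ | _) (_ | _) <;> rfl
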